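/- Let 1 ≤ i ≤ j ≤ r, and for each i ≤ t ≤ j let k_t be an integer with 1 ≤ k_t ≤ t + 1; let π_{k_t} denote the cycle with ambient index t. Then the number of simple roots sent to negative roots satisfies #{l ∈ {1, …, r} : π_{k_i} π_{k_{i+1}} ⋯ π_{k_j}(α_l) is a negative root} ≤ j − i + 1. -/

import Mathlib

open Equiv Finset

/-- The simple reflection `s i = (i, i+1)` (1-based) in `S_{r+1}`, for `1 ≤ i ≤ r`;
the junk value `1` otherwise. -/
def sr (r i : ℕ) : Equiv.Perm (Fin (r + 1)) :=
  if h : 1 ≤ i ∧ i ≤ r then Equiv.swap ⟨i - 1, by omega⟩ ⟨i, by omega⟩ else 1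

/-- The cycle `π_k` with ambient index `i`, i.e. `s_i s_{i-1} ⋯ s_k`
(the identity when `k = i + 1`). -/
def cyc (r i k : ℕ) : Equiv.Perm (Fin (r + 1)) :=
  ((List.range (i + 1 - k)).map fun t => sr r (i - t)).prod

/-- The product `π_{k i} π_{k (i+1)} ⋯ π_{k j}`, the factor `π_{k t}` being the
cycle with ambient index `t`. -/
def cycProd (r : ℕ) (k : ℕ → ℕ) (i j : ℕ) : Equiv.Perm (Fin (r + 1)) :=
  ((List.range' i (j + 1 - i)).map fun t => cyc r t (k t)).prod

/-- Coxeter length of a permutation: the number of inversions. -/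
def lenInv {n : ℕ} (w : Equiv.Perm (Fin n)) : ℕ :=
  (Finset.univ.filter fun p : Fin n × Fin n => p.1 < p.2 ∧ w p.2 < w p.1).card

/-- Partial sums of a (1-based) composition: `psum c j = c 1 + ⋯ + c j`. -/
def psum (c : ℕ → ℕ) (j : ℕ) : ℕ := ∑ i ∈ Finset.Icc 1 j, c i

/-- The transpose partition of `(t 1, …, t b)`: `transp b t j = #{i ∈ [1,b] : t i ≥ j}`. -/
def transp (b : ℕ) (t : ℕ → ℕ) (j : ℕ) : ℕ :=
  ((Finset.Icc 1 b).filter fun i => j ≤ t i).card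

/-- The element of `Fin (r+1)` with value `i` (for `i ≤ r`). -/
def finOf (r i : ℕ) : Fin (r + 1) := ⟨min i r, by omega⟩

/-- `w(α_i)` is a positive root, where `α_i = e_i − e_{i+1}` (1-based), i.e. the
0-based pair `(i-1, i)`; `w(e_c − e_d) = e_{w c} − e_{w d}` is positive iff `w c < w d`. -/
def posRoot (r : ℕ) (w : Equiv.Perm (Fin (r + 1))) (i : ℕ) : Prop :=
  (w (finOf r (i - 1)) : ℕ) < w (finOf r i)

/-- `w(α_i)` is a negative root. -/
def negRoot (r : ℕ) (w : Equiv.Perm (Fin (r + 1))) (i : ℕ) : Prop :=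
  (w (finOf r i) : ℕ) < w (finOf r (i - 1))

/-- `w(α_i)` is a simple root. -/
def simpleRoot (r : ℕ) (w : Equiv.Perm (Fin (r + 1))) (i : ℕ) : Prop :=
  (w (finOf r i) : ℕ) = (w (finOf r (i - 1)) : ℕ) + 1

/-- `w(α_i) = α_j` (as roots: the image pair is `(j-1, j)` in 0-based indices). -/
def eqRoot (r : ℕ) (w : Equiv.Perm (Fin (r + 1))) (i j : ℕ) : Prop :=
  (w (finOf r (i - 1)) : ℕ) = j - 1 ∧ (w (finOf r i) : ℕ) = j

/-- `Π_l Π_{l+1} ⋯ Π_a` for the composition `c` and tuple `k`, where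
`Π_j = π_{k_{x_{j-1}}} ⋯ π_{k_{x_j - 1}}` and `x_j = psum c j`. -/
def tailProd (r a : ℕ) (c k : ℕ → ℕ) (l : ℕ) : Equiv.Perm (Fin (r + 1)) :=
  ((List.range' l (a + 1 - l)).map fun j => cycProd r k (psum c (j - 1)) (psum c j - 1)).prod

/-- The subgroup `W(P)`: generated by the simple reflections `s i` with `i ∈ [1,r]`
avoiding the partial sums `x 1, …, x (a-1)` of the composition `c`. -/
def WP (r a : ℕ) (c : ℕ → ℕ) : Subgroup (Equiv.Perm (Fin (r + 1))) :=
  Subgroup.closure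
    {g | ∃ i, 1 ≤ i ∧ i ≤ r ∧ (∀ j, 1 ≤ j → j ≤ a - 1 → i ≠ psum c j) ∧ g = sr r i}

/-- `α_i ∈ Δ_λ` for the composition `λ = (p 1, …, p m)` of `r+1`. -/
def inDelta (r m : ℕ) (p : ℕ → ℕ) (i : ℕ) : Prop :=
  1 ≤ i ∧ i ≤ r ∧ ∀ j, 1 ≤ j → j ≤ m - 1 → i ≠ psum p j

/-- The left coset `H · g`. -/
def cosetOf {G : Type*} [Group G] (H : Subgroup G) (g : G) : Set G :=
  {x | ∃ h ∈ H, x = h * g}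

/-- The (0-based) positions `u` and `v` lie in the same block of the composition
`μ^⊤ = transp b t`; a negative root `e_c − e_d` lies in `Φ⁻_{μ^⊤}` iff its two
indices lie in the same block. -/
def sameBlock (b : ℕ) (t : ℕ → ℕ) (u v : ℕ) : Prop :=
  ∃ j, 1 ≤ j ∧ j ≤ t 1 ∧
    psum (transp b t) (j - 1) ≤ u ∧ u < psum (transp b t) j ∧
    psum (transp b t) (j - 1) ≤ v ∧ v < psum (transp b t) j

/-- The positions `a` that are the left end of some inversion of `w`. -/
def inversionStarts {n : ℕ} (w : Equiv.Perm (Fin n)) : Finset (Fin n) :=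
  Finset.univ.filter fun a => ∃ b, a < b ∧ w b < w a

theorem mem_inversionStarts {n : ℕ} {w : Equiv.Perm (Fin n)} {a : Fin n} :
    a ∈ inversionStarts w ↔ ∃ b, a < b ∧ w b < w a := by
  simp [inversionStarts]

theorem card_inversionStarts_one {n : ℕ} :
    (inversionStarts (1 : Equiv.Perm (Fin n))).card = 0 := by
  rw [Finset.card_eq_zero, Finset.eq_empty_iff_forall_notMem]
  intro a ha
  obtain ⟨b, hab, hba⟩ := mem_inversionStarts.1 ha
  exact lt_asymm hab hba

theorem card_inversionStarts_mul_le {n : ℕ} (u v : Equiv.Perm (Fin n)) :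
    (inversionStarts (u * v)).card ≤ (inversionStarts u).card + (inversionStarts v).card := by
  have hsub : inversionStarts (u * v) ⊆
      (inversionStarts u).map v.symm.toEmbedding ∪ inversionStarts v := by
    intro a ha
    obtain ⟨b, hab, hba⟩ := mem_inversionStarts.1 ha
    by_cases hv : a ∈ inversionStarts v
    · exact Finset.mem_union_right _ hv
    · refine Finset.mem_union_left _ (Finset.mem_map.2 ⟨v a, ?_, by simp⟩)
      refine mem_inversionStarts.2 ⟨v b, ?_, hba⟩
      refine lt_of_le_of_ne (not_lt.1 fun h => hv (mem_inversionStarts.2 ⟨b, hab, h⟩)) ?_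
      exact fun h => hab.ne (v.injective h)
  calc _ ≤ _ := Finset.card_le_card hsub
    _ ≤ _ := Finset.card_union_le _ _
    _ = _ := by rw [Finset.card_map]

theorem card_inversionStarts_prod_le {n : ℕ} (L : List (Equiv.Perm (Fin n)))
    (hL : ∀ w ∈ L, (inversionStarts w).card ≤ 1) :
    (inversionStarts L.prod).card ≤ L.length := by
  induction L with
  | nil => simp [card_inversionStarts_one]
  | cons w L ih =>
    have h₁ := hL w (by simp)
    have h₂ := ih fun u hu => hL u (by simp [hu])
    have h₃ := card_inversionStarts_mul_le w L.prod
    simp only [List.prod_cons, List.length_cons]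
    omega

theorem sr_apply_val {r i : ℕ} (hi : 1 ≤ i) (hir : i ≤ r) (a : Fin (r + 1)) :
    (sr r i a : ℕ) = if (a : ℕ) = i - 1 then i else if (a : ℕ) = i then i - 1 else a := by
  simp only [sr, hi, hir, and_self, dite_true, Equiv.swap_apply_def, Fin.ext_iff]
  split_ifs <;> rfl

theorem prod_range_sr_apply_val {r i : ℕ} (hir : i ≤ r) (n : ℕ) (hn : n ≤ i) (a : Fin (r + 1)) :
    ((((List.range n).map fun t => sr r (i - t)).prod a : Fin (r + 1)) : ℕ) =
      if (a : ℕ) = i - n then i else if i - n < a ∧ (a : ℕ) ≤ i then a - 1 else a := by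
  induction n generalizing a with
  | zero => simp only [List.range_zero, List.map_nil, List.prod_nil, Equiv.Perm.one_apply]; grind
  | succ n ih =>
    rw [List.range_succ, List.map_append, List.prod_append, Equiv.Perm.mul_apply,
      ih (by omega)]
    simp only [List.map_cons, List.map_nil, List.prod_singleton,
      sr_apply_val (show 1 ≤ i - n by omega) (show i - n ≤ r by omega)]
    split_ifs <;> omega

theorem card_inversionStarts_cyc_le {r i k : ℕ} (hir : i ≤ r) (hk : 1 ≤ k) :
    (inversionStarts (cyc r i k)).card ≤ 1 := by
  have key : ∀ a ∈ inversionStarts (cyc r i k), (a : ℕ) = i - (i + 1 - k) := by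
    intro a ha
    obtain ⟨b, hab, hba⟩ := mem_inversionStarts.1 ha
    rw [Fin.lt_def] at hab hba
    rw [cyc, prod_range_sr_apply_val hir _ (by omega),
      prod_range_sr_apply_val hir _ (by omega)] at hba
    split_ifs at hba <;> omega
  exact Finset.card_le_one.2 fun a ha b hb => Fin.ext ((key a ha).trans (key b hb).symm)

/-- `#{l ∈ {1, …, r} : π_{k_i} ⋯ π_{k_j}(α_l) < 0} ≤ j − i + 1`
(the index `l ∈ {1, …, r}` is encoded by `l' : Fin r` with `l = l' + 1`). -/
theorem stmt11 (r i j : ℕ) (hi : 1 ≤ i) (hij : i ≤ j) (hjr : j ≤ r) (k : ℕ → ℕ)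
    (hk : ∀ t, i ≤ t → t ≤ j → 1 ≤ k t ∧ k t ≤ t + 1) :
    ((Finset.univ : Finset (Fin r)).filter fun l : Fin r =>
        (cycProd r k i j (finOf r ((l : ℕ) + 1)) : ℕ)
          < cycProd r k i j (finOf r (l : ℕ))).card
      ≤ j - i + 1 := by
  have hprod : (inversionStarts (cycProd r k i j)).card ≤ j + 1 - i := by
    refine (card_inversionStarts_prod_le _ ?_).trans (by simp)
    intro w hw
    obtain ⟨t, ht, rfl⟩ := List.mem_map.1 hw
    rw [List.mem_range'_1] at ht
    exact card_inversionStarts_cyc_le (by omega) (hk t (by omega) (by omega)).1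
  refine le_trans ?_ (hprod.trans (by omega))
  refine Finset.card_le_card_of_injOn (fun l => finOf r l) ?_ ?_
  · intro l hl
    have hl' := (Finset.mem_filter.1 (Finset.mem_coe.1 hl)).2
    refine Finset.mem_coe.2 (mem_inversionStarts.2 ⟨finOf r (l + 1), ?_, hl'⟩)
    simp only [finOf, Fin.lt_def]
    omega
  · intro a _ b _ hab
    simp only [finOf, Fin.ext_iff] at hab ⊢
    omega
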